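/- Inner bound (Theorem 1): For the two-user memoryless FS-MAC with i.i.d. state, causal asymmetric noisy state information at the encoders and complete state information at the decoder, the closure of the convex hull of the union over all memoryless stationary team policies π of the regions ℛ(π) is contained in the capacity region C_FS; i.e., C_IN := cl conv(∪_π ℛ(π)) ⊆ C_FS. -/

import Mathlib

open scoped BigOperators
open Finset

noncomputable section

/-- Shannon entropy (base 2) of a pmf on a finite type (convention `0 * log 0 = 0`). -/
def ent {α : Type} [Fintype α] (p : α → ℝ) : ℝ :=
  -∑ x, p x * Real.logb 2 (p x)

/-- `p` is a probability mass function. -/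
def isPMF {α : Type} [Fintype α] (p : α → ℝ) : Prop :=
  (∀ x, 0 ≤ p x) ∧ ∑ x, p x = 1

/-- Mutual information `I(A;B)` computed from a joint pmf on `α × β`. -/
def mutInfo {α β : Type} [Fintype α] [Fintype β] (p : α × β → ℝ) : ℝ :=
  ent (fun a => ∑ b, p (a, b)) + ent (fun b => ∑ a, p (a, b)) - ent p

/-- Conditional mutual information `I(A;B|C)` computed from a joint pmf on `α × β × γ`. -/
def condMutInfo {α β γ : Type} [Fintype α] [Fintype β] [Fintype γ]
    (p : α × β × γ → ℝ) : ℝ :=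
  ent (fun ac : α × γ => ∑ b, p (ac.1, b, ac.2))
    + ent (fun bc : β × γ => ∑ a, p (a, bc.1, bc.2))
    - ent p
    - ent (fun c : γ => ∑ a, ∑ b, p (a, b, c))

/-- A two-user memoryless finite-state MAC with i.i.d. state, noisy causal CSIT
(through the kernels `Qa`, `Qb`) and complete CSIR. -/
structure FSMAC (S Sa Sb Xa Xb Y : Type) [Fintype S] [Fintype Sa] [Fintype Sb]
    [Fintype Xa] [Fintype Xb] [Fintype Y] : Type where
  PS : S → ℝ
  Qa : S → Sa → ℝ
  Qb : S → Sb → ℝ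
  chan : Xa → Xb → S → Y → ℝ
  PS_pmf : isPMF PS
  Qa_pmf : ∀ s, isPMF (Qa s)
  Qb_pmf : ∀ s, isPMF (Qb s)
  chan_pmf : ∀ xa xb s, isPMF (chan xa xb s)

variable {S Sa Sb Xa Xb Y : Type} [Fintype S] [Fintype Sa] [Fintype Sb]
  [Fintype Xa] [Fintype Xb] [Fintype Y] [DecidableEq Sa] [DecidableEq Sb]

/-- `P_{Y|T^a,T^b,S}(y|t^a,t^b,s)`: channel kernel at the level of Shannon strategies. -/
def stratKernel (M : FSMAC S Sa Sb Xa Xb Y) (ta : Sa → Xa) (tb : Sb → Xb)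
    (s : S) (y : Y) : ℝ :=
  ∑ sa, ∑ sb, M.Qa s sa * M.Qb s sb * M.chan (ta sa) (tb sb) s y

/-- Joint single-letter law of `((T^a,T^b),Y,S)` induced by a memoryless stationary
team policy `(πa, πb)`. -/
def teamLaw (M : FSMAC S Sa Sb Xa Xb Y) (πa : (Sa → Xa) → ℝ) (πb : (Sb → Xb) → ℝ) :
    ((Sa → Xa) × (Sb → Xb)) × Y × S → ℝ :=
  fun x => M.PS x.2.2 * πa x.1.1 * πb x.1.2 * stratKernel M x.1.1 x.1.2 x.2.2 x.2.1

/-- `I(T^a;Y|T^b,S)` under the team policy law. -/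
def Ia (M : FSMAC S Sa Sb Xa Xb Y) (πa : (Sa → Xa) → ℝ) (πb : (Sb → Xb) → ℝ) : ℝ :=
  condMutInfo (fun x : (Sa → Xa) × Y × ((Sb → Xb) × S) =>
    teamLaw M πa πb ((x.1, x.2.2.1), x.2.1, x.2.2.2))

/-- `I(T^b;Y|T^a,S)` under the team policy law. -/
def Ib (M : FSMAC S Sa Sb Xa Xb Y) (πa : (Sa → Xa) → ℝ) (πb : (Sb → Xb) → ℝ) : ℝ :=
  condMutInfo (fun x : (Sb → Xb) × Y × ((Sa → Xa) × S) =>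
    teamLaw M πa πb ((x.2.2.1, x.1), x.2.1, x.2.2.2))

/-- `I(T^a,T^b;Y|S)` under the team policy law. -/
def Isum (M : FSMAC S Sa Sb Xa Xb Y) (πa : (Sa → Xa) → ℝ) (πb : (Sb → Xb) → ℝ) : ℝ :=
  condMutInfo (teamLaw M πa πb)

/-- The region `ℛ(π)` of a memoryless stationary team policy `π = (πa, πb)`. -/
def rateRegion (M : FSMAC S Sa Sb Xa Xb Y) (πa : (Sa → Xa) → ℝ)
    (πb : (Sb → Xb) → ℝ) : Set (ℝ × ℝ) :=
  {R : ℝ × ℝ | 0 ≤ R.1 ∧ 0 ≤ R.2 ∧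
    R.1 < Ia M πa πb ∧ R.2 < Ib M πa πb ∧ R.1 + R.2 < Isum M πa πb}

/-- A block code with causal encoders (encoder `a` sees `S^a_{[t]}`, encoder `b`
sees `S^b_{[t]}`) and a decoder with complete state information. -/
structure Code (M : FSMAC S Sa Sb Xa Xb Y) (n : ℕ) (Wa Wb : Type) : Type where
  encA : (t : Fin n) → (Fin (t.1 + 1) → Sa) → Wa → Xa
  encB : (t : Fin n) → (Fin (t.1 + 1) → Sb) → Wb → Xb
  dec : (Fin n → S) → (Fin n → Y) → Wa × Wb

/-- Joint pmf on messages, state sequences, noisy-observation sequences and outputs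
induced by a code (messages uniform and independent; memoryless channel and state). -/
def codeProb (M : FSMAC S Sa Sb Xa Xb Y) {n : ℕ} {Wa Wb : Type}
    [Fintype Wa] [Fintype Wb] (C : Code M n Wa Wb) (wa : Wa) (wb : Wb)
    (s : Fin n → S) (sa : Fin n → Sa) (sb : Fin n → Sb) (y : Fin n → Y) : ℝ :=
  (Fintype.card Wa : ℝ)⁻¹ * (Fintype.card Wb : ℝ)⁻¹ *
    ∏ t : Fin n,
      (M.PS (s t) * M.Qa (s t) (sa t) * M.Qb (s t) (sb t) *
        M.chan (C.encA t (fun i => sa (Fin.castLE t.isLt i)) wa)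
          (C.encB t (fun i => sb (Fin.castLE t.isLt i)) wb) (s t) (y t))

open Classical in
/-- Probability of an event under the code-induced joint law. -/
def codePr (M : FSMAC S Sa Sb Xa Xb Y) {n : ℕ} {Wa Wb : Type}
    [Fintype Wa] [Fintype Wb] (C : Code M n Wa Wb)
    (E : Wa → Wb → (Fin n → S) → (Fin n → Sa) → (Fin n → Sb) → (Fin n → Y) → Prop) : ℝ :=
  ∑ wa, ∑ wb, ∑ s, ∑ sa, ∑ sb, ∑ y,
    if E wa wb s sa sb y then codeProb M C wa wb s sa sb y else 0

/-- Average probability of error of a code. -/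
def errProb (M : FSMAC S Sa Sb Xa Xb Y) {n : ℕ} {Wa Wb : Type}
    [Fintype Wa] [Fintype Wb] (C : Code M n Wa Wb) : ℝ :=
  codePr M C (fun wa wb s _ _ y => C.dec s y ≠ (wa, wb))

/-- A rate pair is achievable if for every `ε > 0` and all large enough `n` there is a
code of blocklength `n` with rates at least `(Ra, Rb)` and error probability `≤ ε`. -/
def Achievable (M : FSMAC S Sa Sb Xa Xb Y) (Ra Rb : ℝ) : Prop :=
  0 ≤ Ra ∧ 0 ≤ Rb ∧
    ∀ ε : ℝ, 0 < ε → ∃ N : ℕ, ∀ n : ℕ, N ≤ n →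
      ∃ (Ma Mb : ℕ) (C : Code M n (Fin Ma) (Fin Mb)),
        Ra ≤ Real.logb 2 Ma / n ∧ Rb ≤ Real.logb 2 Mb / n ∧ errProb M C ≤ ε

/-- The capacity region `C_FS`: closure of the set of achievable rate pairs. -/
def capRegion (M : FSMAC S Sa Sb Xa Xb Y) : Set (ℝ × ℝ) :=
  closure {R : ℝ × ℝ | Achievable M R.1 R.2}

/-- `sup_{π_{T^a} ⊗ π_{T^b}} I(T^a,T^b;Y|S)`. -/
def sumRateSup (M : FSMAC S Sa Sb Xa Xb Y) : ℝ :=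
  sSup {x : ℝ | ∃ (πa : (Sa → Xa) → ℝ) (πb : (Sb → Xb) → ℝ),
    isPMF πa ∧ isPMF πb ∧ x = Isum M πa πb}

/-- Binary entropy function (base 2). -/
def binEnt (x : ℝ) : ℝ := -(x * Real.logb 2 x) - (1 - x) * Real.logb 2 (1 - x)

set_option linter.unusedSectionVars false

/-! ### One-shot random coding for the multiple access channel -/

/-- Indicator of a proposition, as a real number. -/
def ind (p : Prop) : ℝ := by
  classical exact if p then 1 else 0

lemma ind_true {p : Prop} (h : p) : ind p = 1 := by simp [ind, h]

lemma ind_false {p : Prop} (h : ¬ p) : ind p = 0 := by simp [ind, h]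

lemma ind_nonneg (p : Prop) : 0 ≤ ind p := by
  by_cases h : p
  · rw [ind_true h]; norm_num
  · rw [ind_false h]

lemma ind_le_one (p : Prop) : ind p ≤ 1 := by
  by_cases h : p
  · rw [ind_true h]
  · rw [ind_false h]; norm_num

lemma ind_mono {p q : Prop} (h : p → q) : ind p ≤ ind q := by
  by_cases hp : p
  · rw [ind_true hp, ind_true (h hp)]
  · rw [ind_false hp]; exact ind_nonneg _

/-- Sum of products over functions is a product of sums. -/
lemma sum_fun_prod {W A : Type} [Fintype W] [DecidableEq W] [Fintype A] (g : W → A → ℝ) :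
    ∑ c : W → A, ∏ w, g w (c w) = ∏ w, ∑ a, g w a :=
  (Fintype.prod_sum g).symm

lemma sum_cb0 {W A : Type} [Fintype W] [DecidableEq W] [Fintype A] (p : A → ℝ)
    (hp : ∑ a, p a = 1) :
    ∑ c : W → A, ∏ w, p (c w) = 1 := by
  rw [sum_fun_prod (fun _ a => p a)]; simp [hp]

lemma sum_cb1 {W A : Type} [Fintype W] [DecidableEq W] [Fintype A] (p : A → ℝ)
    (hp : ∑ a, p a = 1) (w₀ : W) (f : A → ℝ) :
    ∑ c : W → A, (∏ w, p (c w)) * f (c w₀) = ∑ a, p a * f a := by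
  have h : ∀ c : W → A, (∏ w, p (c w)) * f (c w₀)
      = ∏ w, (p (c w) * if w = w₀ then f (c w) else 1) := by
    intro c
    rw [Finset.prod_mul_distrib]
    congr 1
    rw [Finset.prod_ite_eq' Finset.univ w₀ (fun w => f (c w))]
    simp
  simp_rw [h]
  rw [sum_fun_prod (fun w a => p a * if w = w₀ then f a else 1)]
  rw [Finset.prod_eq_single w₀]
  · simp
  · intro b _ hb
    simp [hb, hp]
  · simp

lemma sum_cb2' {W A : Type} [Fintype W] [DecidableEq W] [Fintype A] (p : A → ℝ)
    (hp : ∑ a, p a = 1) (w₀ w₁ : W) (hw : w₀ ≠ w₁) (f g : A → ℝ) :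
    ∑ c : W → A, (∏ w, p (c w)) * (f (c w₀) * g (c w₁))
      = (∑ a, p a * f a) * (∑ a, p a * g a) := by
  have h : ∀ c : W → A, (∏ w, p (c w)) * (f (c w₀) * g (c w₁))
      = ∏ w, (p (c w) * ((if w = w₀ then f (c w) else 1) *
          (if w = w₁ then g (c w) else 1))) := by
    intro c
    rw [Finset.prod_mul_distrib, Finset.prod_mul_distrib]
    congr 1
    rw [Finset.prod_ite_eq' Finset.univ w₀ (fun w => f (c w)),
      Finset.prod_ite_eq' Finset.univ w₁ (fun w => g (c w))]
    simp
  simp_rw [h]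
  rw [sum_fun_prod (fun w a => p a * ((if w = w₀ then f a else 1) *
          (if w = w₁ then g a else 1)))]
  rw [← Finset.mul_prod_erase Finset.univ _ (Finset.mem_univ w₀)]
  rw [Finset.prod_eq_single w₁]
  · simp [hw, hw.symm]
  · intro b hb hb1
    have hb0 : b ≠ w₀ := (Finset.mem_erase.1 hb).1
    simp [hb0, hb1, hp]
  · intro hh
    exact absurd (Finset.mem_erase.2 ⟨hw.symm, Finset.mem_univ _⟩) hh

lemma sum_cb2 {W A : Type} [Fintype W] [DecidableEq W] [Fintype A] (p : A → ℝ)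
    (hp : ∑ a, p a = 1) (w₀ w₁ : W) (hw : w₀ ≠ w₁) (f : A → A → ℝ) :
    ∑ c : W → A, (∏ w, p (c w)) * f (c w₀) (c w₁)
      = ∑ a, ∑ a', p a * (p a' * f a a') := by
  classical
  have h : ∀ c : W → A, (∏ w, p (c w)) * f (c w₀) (c w₁)
      = ∑ a', (∏ w, p (c w)) * (f (c w₀) a' * (if c w₁ = a' then 1 else 0)) := by
    intro c
    rw [← Finset.mul_sum]
    simp
  simp_rw [h]
  rw [Finset.sum_comm]
  conv_rhs => rw [Finset.sum_comm]
  refine Finset.sum_congr rfl fun a' _ => ?_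
  rw [sum_cb2' p hp w₀ w₁ hw (fun a => f a a') (fun a => if a = a' then 1 else 0)]
  simp only [mul_ite, mul_one, mul_zero, Finset.sum_ite_eq', Finset.mem_univ, if_true]
  rw [Finset.sum_mul]
  exact Finset.sum_congr rfl fun a _ => by ring

/-- Expectation over a pair of independent random codebooks. -/
def Ecb {W₁ W₂ A B : Type} [Fintype W₁] [DecidableEq W₁] [Fintype W₂] [DecidableEq W₂]
    [Fintype A] [Fintype B] (pa : A → ℝ) (pb : B → ℝ) (F : (W₁ → A) → (W₂ → B) → ℝ) : ℝ :=
  ∑ ca : W₁ → A, ∑ cb : W₂ → B, (∏ w, pa (ca w)) * ((∏ w, pb (cb w)) * F ca cb)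

section
variable {W₁ W₂ A B V : Type} [Fintype W₁] [DecidableEq W₁] [Fintype W₂] [DecidableEq W₂]
    [Fintype A] [Fintype B] [Fintype V] {pa : A → ℝ} {pb : B → ℝ}

lemma Ecb_mono (ha : isPMF pa) (hb : isPMF pb) {F G : (W₁ → A) → (W₂ → B) → ℝ}
    (h : ∀ ca cb, F ca cb ≤ G ca cb) : Ecb pa pb F ≤ Ecb pa pb G := by
  refine Finset.sum_le_sum fun ca _ => Finset.sum_le_sum fun cb _ => ?_
  refine mul_le_mul_of_nonneg_left (mul_le_mul_of_nonneg_left (h ca cb) ?_) ?_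
  · exact Finset.prod_nonneg fun _ _ => hb.1 _
  · exact Finset.prod_nonneg fun _ _ => ha.1 _

lemma Ecb_add (F G : (W₁ → A) → (W₂ → B) → ℝ) :
    Ecb pa pb (fun ca cb => F ca cb + G ca cb) = Ecb pa pb F + Ecb pa pb G := by
  simp only [Ecb, mul_add, Finset.sum_add_distrib]

lemma Ecb_const_mul (k : ℝ) (F : (W₁ → A) → (W₂ → B) → ℝ) :
    Ecb pa pb (fun ca cb => k * F ca cb) = k * Ecb pa pb F := by
  simp only [Ecb, Finset.mul_sum]
  refine Finset.sum_congr rfl fun ca _ => Finset.sum_congr rfl fun cb _ => ?_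
  ring

lemma Ecb_sum {ι : Type} (s : Finset ι) (F : ι → (W₁ → A) → (W₂ → B) → ℝ) :
    Ecb pa pb (fun ca cb => ∑ i ∈ s, F i ca cb) = ∑ i ∈ s, Ecb pa pb (F i) := by
  simp only [Ecb, Finset.mul_sum]
  conv_rhs => rw [Finset.sum_comm]
  refine Finset.sum_congr rfl fun ca _ => ?_
  rw [Finset.sum_comm]

lemma Ecb_const (ha : isPMF pa) (hb : isPMF pb) (k : ℝ) :
    Ecb (W₁ := W₁) (W₂ := W₂) pa pb (fun _ _ => k) = k := by
  simp only [Ecb]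
  simp_rw [← Finset.mul_sum, ← Finset.sum_mul]
  rw [sum_cb0 pa ha.2, sum_cb0 pb hb.2]; ring

lemma Ecb_11 (ha : isPMF pa) (hb : isPMF pb) (w₁ : W₁) (w₂ : W₂) (f : A → B → ℝ) :
    Ecb pa pb (fun (ca : W₁ → A) (cb : W₂ → B) => f (ca w₁) (cb w₂))
      = ∑ a, ∑ b, pa a * (pb b * f a b) := by
  simp only [Ecb]
  simp_rw [← Finset.mul_sum]
  rw [← sum_cb1 pa ha.2 w₁ (fun a => ∑ b, pb b * f a b)]
  refine Finset.sum_congr rfl fun ca _ => ?_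
  rw [sum_cb1 pb hb.2 w₂]

lemma Ecb_21 (ha : isPMF pa) (hb : isPMF pb) (w₁ w₁' : W₁) (hw : w₁ ≠ w₁') (w₂ : W₂)
    (f : A → A → B → ℝ) :
    Ecb pa pb (fun (ca : W₁ → A) (cb : W₂ → B) => f (ca w₁) (ca w₁') (cb w₂))
      = ∑ a, ∑ a', pa a * (pa a' * ∑ b, pb b * f a a' b) := by
  simp only [Ecb]
  rw [← sum_cb2 pa ha.2 w₁ w₁' hw (fun a a' => ∑ b, pb b * f a a' b)]
  refine Finset.sum_congr rfl fun ca _ => ?_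
  rw [← Finset.mul_sum, sum_cb1 pb hb.2 w₂ (fun b => f (ca w₁) (ca w₁') b)]

lemma Ecb_12 (ha : isPMF pa) (hb : isPMF pb) (w₁ : W₁) (w₂ w₂' : W₂) (hw : w₂ ≠ w₂')
    (f : A → B → B → ℝ) :
    Ecb pa pb (fun (ca : W₁ → A) (cb : W₂ → B) => f (ca w₁) (cb w₂) (cb w₂'))
      = ∑ a, pa a * ∑ b, ∑ b', pb b * (pb b' * f a b b') := by
  simp only [Ecb]
  rw [← sum_cb1 pa ha.2 w₁ (fun a => ∑ b, ∑ b', pb b * (pb b' * f a b b'))]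
  refine Finset.sum_congr rfl fun ca _ => ?_
  rw [← Finset.mul_sum, sum_cb2 pb hb.2 w₂ w₂' hw (fun b b' => f (ca w₁) b b')]

lemma Ecb_22 (ha : isPMF pa) (hb : isPMF pb) (w₁ w₁' : W₁) (hw₁ : w₁ ≠ w₁')
    (w₂ w₂' : W₂) (hw : w₂ ≠ w₂') (f : A → A → B → B → ℝ) :
    Ecb pa pb (fun (ca : W₁ → A) (cb : W₂ → B) => f (ca w₁) (ca w₁') (cb w₂) (cb w₂'))
      = ∑ a, ∑ a', pa a * (pa a' * ∑ b, ∑ b', pb b * (pb b' * f a a' b b')) := by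
  simp only [Ecb]
  rw [← sum_cb2 pa ha.2 w₁ w₁' hw₁ (fun a a' => ∑ b, ∑ b', pb b * (pb b' * f a a' b b'))]
  refine Finset.sum_congr rfl fun ca _ => ?_
  rw [← Finset.mul_sum, sum_cb2 pb hb.2 w₂ w₂' hw (fun b b' => f (ca w₁) (ca w₁') b b')]

/-- An event with a small average has a realization below the average. -/
lemma Ecb_exists (ha : isPMF pa) (hb : isPMF pb) (F : (W₁ → A) → (W₂ → B) → ℝ) (k : ℝ)
    (h : Ecb pa pb F ≤ k) : ∃ ca cb, F ca cb ≤ k := by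
  by_contra hcon
  push Not at hcon
  have hk : Ecb (W₁ := W₁) (W₂ := W₂) pa pb (fun _ _ => k) = k := Ecb_const ha hb k
  have h0 : Ecb pa pb (fun ca cb => F ca cb - k) ≤ 0 := by
    have := Ecb_add (pa := pa) (pb := pb) F (fun _ _ => -k)
    rw [Ecb_const ha hb] at this
    simp only [← sub_eq_add_neg] at this
    rw [this]; linarith
  have hnn : ∀ ca cb, 0 ≤ (∏ w, pa (ca w)) * ((∏ w, pb (cb w)) * (F ca cb - k)) := by
    intro ca cb
    refine mul_nonneg (Finset.prod_nonneg fun _ _ => ha.1 _)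
      (mul_nonneg (Finset.prod_nonneg fun _ _ => hb.1 _) ?_)
    linarith [hcon ca cb]
  have hz : ∀ (ca : W₁ → A) (cb : W₂ → B), (∏ w, pa (ca w)) * (∏ w, pb (cb w)) = 0 := by
    intro ca cb
    have h1 : Ecb pa pb (fun ca cb => F ca cb - k) = 0 :=
      le_antisymm h0 (Finset.sum_nonneg fun ca _ => Finset.sum_nonneg fun cb _ => hnn ca cb)
    have h2 := (Finset.sum_eq_zero_iff_of_nonneg
      (fun ca _ => Finset.sum_nonneg fun cb _ => hnn ca cb)).1 h1 ca (Finset.mem_univ _)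
    have h3 := (Finset.sum_eq_zero_iff_of_nonneg (fun cb _ => hnn ca cb)).1 h2 cb
      (Finset.mem_univ _)
    rw [← mul_assoc] at h3
    rcases mul_eq_zero.1 h3 with h4 | h4
    · exact h4
    · linarith [hcon ca cb]
  have hone : Ecb (W₁ := W₁) (W₂ := W₂) pa pb (fun _ _ => 1) = 1 := Ecb_const ha hb 1
  have : Ecb (W₁ := W₁) (W₂ := W₂) pa pb (fun _ _ => 1) = 0 := by
    refine Finset.sum_eq_zero fun ca _ => Finset.sum_eq_zero fun cb _ => ?_
    rw [mul_one]; exact hz ca cb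
  linarith

end

/-- `P(v|b)`. -/
def margA {A B V : Type} [Fintype A] (pa : A → ℝ) (K : A → B → V → ℝ) (b : B) (v : V) : ℝ :=
  ∑ a, pa a * K a b v

/-- `P(v|a)`. -/
def margB {A B V : Type} [Fintype B] (pb : B → ℝ) (K : A → B → V → ℝ) (a : A) (v : V) : ℝ :=
  ∑ b, pb b * K a b v

/-- `P(v)`. -/
def margAB {A B V : Type} [Fintype A] [Fintype B] (pa : A → ℝ) (pb : B → ℝ)
    (K : A → B → V → ℝ) (v : V) : ℝ :=
  ∑ a, ∑ b, pa a * (pb b * K a b v)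

/-- Threshold typicality. -/
def Gd {A B V : Type} [Fintype A] [Fintype B] (pa : A → ℝ) (pb : B → ℝ)
    (K : A → B → V → ℝ) (θa θb θc : ℝ) (a : A) (b : B) (v : V) : Prop :=
  θa * margA pa K b v < K a b v ∧ θb * margB pb K a v < K a b v ∧
    θc * margAB pa pb K v < K a b v

lemma ind_thresh {θ P k : ℝ} (hθ : 0 < θ) (hk : 0 ≤ k) :
    P * ind (θ * P < k) ≤ θ⁻¹ * k := by
  by_cases h : θ * P < k
  · rw [ind_true h, mul_one, inv_mul_eq_div, le_div_iff₀ hθ]; linarith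
  · rw [ind_false h, mul_zero]; positivity

section
variable {A B V : Type} [Fintype A] [Fintype B] [Fintype V] {pa : A → ℝ} {pb : B → ℝ}
  {K : A → B → V → ℝ}

lemma sum_pabK (ha : isPMF pa) (hb : isPMF pb) (hK : ∀ a b, isPMF (K a b)) (θ : ℝ) :
    ∑ a, pa a * ∑ b, pb b * ∑ v, θ * K a b v = θ := by
  have : ∀ a b, ∑ v, θ * K a b v = θ := by
    intro a b; rw [← Finset.mul_sum, (hK a b).2, mul_one]
  simp_rw [this, ← Finset.sum_mul, hb.2, one_mul, ha.2, one_mul]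

lemma conf_a (ha : isPMF pa) (hb : isPMF pb) (hK : ∀ a b, isPMF (K a b)) {θ : ℝ}
    (hθ : 0 < θ) :
    ∑ a, ∑ a', pa a * (pa a' * ∑ b, pb b * ∑ v, K a b v * ind (θ * margA pa K b v < K a' b v))
      ≤ θ⁻¹ := by
  calc _ = ∑ a', pa a' * ∑ b, pb b * ∑ v, margA pa K b v *
        ind (θ * margA pa K b v < K a' b v) := by
        rw [Finset.sum_comm]
        refine Finset.sum_congr rfl fun a' _ => ?_
        generalize hF : (fun b v => ind (θ * margA pa K b v < K a' b v)) = F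
        have hF' : ∀ b v, ind (θ * margA pa K b v < K a' b v) = F b v := fun b v => by
          rw [← hF]
        simp_rw [hF', margA, Finset.sum_mul, Finset.mul_sum]
        rw [Finset.sum_comm]
        refine Finset.sum_congr rfl fun b _ => ?_
        rw [Finset.sum_comm]
        refine Finset.sum_congr rfl fun v _ => ?_
        refine Finset.sum_congr rfl fun a _ => ?_
        ring
    _ ≤ ∑ a', pa a' * ∑ b, pb b * ∑ v, θ⁻¹ * K a' b v := by
        refine Finset.sum_le_sum fun a _ => mul_le_mul_of_nonneg_left ?_ (ha.1 a)
        refine Finset.sum_le_sum fun b _ => mul_le_mul_of_nonneg_left ?_ (hb.1 b)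
        exact Finset.sum_le_sum fun v _ => ind_thresh hθ ((hK a b).1 v)
    _ = θ⁻¹ := sum_pabK ha hb hK _

lemma conf_b (ha : isPMF pa) (hb : isPMF pb) (hK : ∀ a b, isPMF (K a b)) {θ : ℝ}
    (hθ : 0 < θ) :
    ∑ a, pa a * ∑ b, ∑ b', pb b * (pb b' * ∑ v, K a b v * ind (θ * margB pb K a v < K a b' v))
      ≤ θ⁻¹ := by
  calc _ = ∑ a, pa a * ∑ b', pb b' * ∑ v, margB pb K a v *
        ind (θ * margB pb K a v < K a b' v) := by
        refine Finset.sum_congr rfl fun a _ => ?_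
        congr 1
        rw [Finset.sum_comm]
        refine Finset.sum_congr rfl fun b' _ => ?_
        generalize hF : (fun v => ind (θ * margB pb K a v < K a b' v)) = F
        have hF' : ∀ v, ind (θ * margB pb K a v < K a b' v) = F v := fun v => by
          rw [← hF]
        simp_rw [hF', margB, Finset.sum_mul, Finset.mul_sum]
        rw [Finset.sum_comm]
        refine Finset.sum_congr rfl fun v _ => ?_
        refine Finset.sum_congr rfl fun b _ => ?_
        ring
    _ ≤ ∑ a', pa a' * ∑ b, pb b * ∑ v, θ⁻¹ * K a' b v := by
        refine Finset.sum_le_sum fun a _ => mul_le_mul_of_nonneg_left ?_ (ha.1 a)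
        refine Finset.sum_le_sum fun b _ => mul_le_mul_of_nonneg_left ?_ (hb.1 b)
        exact Finset.sum_le_sum fun v _ => ind_thresh hθ ((hK a b).1 v)
    _ = θ⁻¹ := sum_pabK ha hb hK _

lemma conf_c (ha : isPMF pa) (hb : isPMF pb) (hK : ∀ a b, isPMF (K a b)) {θ : ℝ}
    (hθ : 0 < θ) :
    ∑ a, ∑ a', pa a * (pa a' * ∑ b, ∑ b', pb b * (pb b' * ∑ v, K a b v *
      ind (θ * margAB pa pb K v < K a' b' v))) ≤ θ⁻¹ := by
  calc _ = ∑ a', pa a' * ∑ b', pb b' * ∑ v, margAB pa pb K v *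
        ind (θ * margAB pa pb K v < K a' b' v) := by
        rw [Finset.sum_comm]
        refine Finset.sum_congr rfl fun a' _ => ?_
        generalize hF : (fun b' v => ind (θ * margAB pa pb K v < K a' b' v)) = F
        have hF' : ∀ b' v, ind (θ * margAB pa pb K v < K a' b' v) = F b' v := fun b' v => by
          rw [← hF]
        simp_rw [hF', margAB, Finset.sum_mul, Finset.mul_sum]
        calc _ = ∑ a, ∑ b', ∑ b, ∑ v, pa a * (pa a' * (pb b * (pb b' * (K a b v * F b' v)))) :=
              Finset.sum_congr rfl fun a _ => Finset.sum_comm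
          _ = ∑ b', ∑ a, ∑ b, ∑ v, pa a * (pa a' * (pb b * (pb b' * (K a b v * F b' v)))) :=
              Finset.sum_comm
          _ = ∑ b', ∑ v, ∑ a, ∑ b, pa a * (pa a' * (pb b * (pb b' * (K a b v * F b' v)))) := by
              refine Finset.sum_congr rfl fun b' _ => ?_
              rw [Finset.sum_comm (γ := V)]
              exact Finset.sum_congr rfl fun a _ => Finset.sum_comm
          _ = _ := by
              refine Finset.sum_congr rfl fun b' _ => ?_
              refine Finset.sum_congr rfl fun v _ => ?_
              refine Finset.sum_congr rfl fun a _ => ?_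
              refine Finset.sum_congr rfl fun b _ => ?_
              ring
    _ ≤ ∑ a', pa a' * ∑ b, pb b * ∑ v, θ⁻¹ * K a' b v := by
        refine Finset.sum_le_sum fun a _ => mul_le_mul_of_nonneg_left ?_ (ha.1 a)
        refine Finset.sum_le_sum fun b _ => mul_le_mul_of_nonneg_left ?_ (hb.1 b)
        exact Finset.sum_le_sum fun v _ => ind_thresh hθ ((hK a b).1 v)
    _ = θ⁻¹ := sum_pabK ha hb hK _

end

section
variable {W₁ W₂ A B V : Type} [Fintype W₁] [DecidableEq W₁] [Fintype W₂] [DecidableEq W₂]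
    [Fintype A] [Fintype B] [Fintype V]

open Classical in
/-- Threshold decoder for a given pair of codebooks. -/
def thDec [Nonempty W₁] [Nonempty W₂] (G : A → B → V → Prop) (ca : W₁ → A) (cb : W₂ → B)
    (v : V) : W₁ × W₂ :=
  if h : ∃ w : W₁ × W₂, G (ca w.1) (cb w.2) v then h.choose else Classical.arbitrary _

lemma thDec_err [Nonempty W₁] [Nonempty W₂] (G : A → B → V → Prop) (ca : W₁ → A)
    (cb : W₂ → B) (v : V) (wa : W₁) (wb : W₂) :
    ind (thDec G ca cb v ≠ (wa, wb)) ≤ ind (¬ G (ca wa) (cb wb) v)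
      + ∑ wa' ∈ Finset.univ.erase wa, ind (G (ca wa') (cb wb) v)
      + ∑ wb' ∈ Finset.univ.erase wb, ind (G (ca wa) (cb wb') v)
      + ∑ wa' ∈ Finset.univ.erase wa, ∑ wb' ∈ Finset.univ.erase wb,
          ind (G (ca wa') (cb wb') v) := by
  have n1 := ind_nonneg (¬ G (ca wa) (cb wb) v)
  have n2 : 0 ≤ ∑ wa' ∈ Finset.univ.erase wa, ind (G (ca wa') (cb wb) v) :=
    Finset.sum_nonneg fun _ _ => ind_nonneg _
  have n3 : 0 ≤ ∑ wb' ∈ Finset.univ.erase wb, ind (G (ca wa) (cb wb') v) :=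
    Finset.sum_nonneg fun _ _ => ind_nonneg _
  have n4 : 0 ≤ ∑ wa' ∈ Finset.univ.erase wa, ∑ wb' ∈ Finset.univ.erase wb,
      ind (G (ca wa') (cb wb') v) :=
    Finset.sum_nonneg fun _ _ => Finset.sum_nonneg fun _ _ => ind_nonneg _
  by_cases hd : thDec G ca cb v = (wa, wb)
  · rw [ind_false (by simpa using hd)]; linarith
  rw [ind_true hd]
  by_cases hG : G (ca wa) (cb wb) v
  swap
  · rw [ind_true hG]; linarith
  have hex : ∃ w : W₁ × W₂, G (ca w.1) (cb w.2) v := ⟨(wa, wb), hG⟩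
  have hspec : G (ca (thDec G ca cb v).1) (cb (thDec G ca cb v).2) v := by
    have : thDec G ca cb v = hex.choose := by simp only [thDec, dif_pos hex]
    rw [this]; exact hex.choose_spec
  generalize hw : thDec G ca cb v = w at hd hspec
  obtain ⟨xa, xb⟩ := w
  simp only at hspec
  by_cases h1 : xa = wa
  · by_cases h2 : xb = wb
    · exact absurd (by rw [h1, h2]) hd
    · subst h1
      have := Finset.single_le_sum (f := fun wb' => ind (G (ca xa) (cb wb') v))
        (fun _ _ => ind_nonneg _) (Finset.mem_erase.2 ⟨h2, Finset.mem_univ xb⟩)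
      simp only [ind_true hspec] at this
      linarith
  · by_cases h2 : xb = wb
    · subst h2
      have := Finset.single_le_sum (f := fun wa' => ind (G (ca wa') (cb xb) v))
        (fun _ _ => ind_nonneg _) (Finset.mem_erase.2 ⟨h1, Finset.mem_univ xa⟩)
      simp only [ind_true hspec] at this
      linarith
    · have h3 := Finset.single_le_sum (f := fun wb' => ind (G (ca xa) (cb wb') v))
        (fun _ _ => ind_nonneg _) (Finset.mem_erase.2 ⟨h2, Finset.mem_univ xb⟩)
      have h4 := Finset.single_le_sum (f := fun wa' => ∑ wb' ∈ Finset.univ.erase wb,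
          ind (G (ca wa') (cb wb') v))
        (fun _ _ => Finset.sum_nonneg fun _ _ => ind_nonneg _)
        (Finset.mem_erase.2 ⟨h1, Finset.mem_univ xa⟩)
      simp only [ind_true hspec] at h3 h4
      linarith

lemma sum_erase_le {W : Type} [Fintype W] [DecidableEq W] (w : W) (f : W → ℝ) (k : ℝ)
    (hk : 0 ≤ k) (h : ∀ w' ∈ Finset.univ.erase w, f w' ≤ k) :
    ∑ w' ∈ Finset.univ.erase w, f w' ≤ (Fintype.card W : ℝ) * k := by
  calc _ ≤ ∑ w' ∈ Finset.univ.erase w, k := Finset.sum_le_sum h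
    _ ≤ ∑ w' : W, k :=
        Finset.sum_le_sum_of_subset_of_nonneg (Finset.erase_subset _ _) fun _ _ _ => hk
    _ = _ := by simp

/-- One-shot random coding bound. -/
theorem one_shot [Nonempty W₁] [Nonempty W₂] {pa : A → ℝ} {pb : B → ℝ}
    {K : A → B → V → ℝ} (ha : isPMF pa) (hb : isPMF pb) (hK : ∀ a b, isPMF (K a b))
    {θa θb θc : ℝ} (hθa : 0 < θa) (hθb : 0 < θb) (hθc : 0 < θc) :
    ∃ (ca : W₁ → A) (cb : W₂ → B) (dec : V → W₁ × W₂),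
      (Fintype.card W₁ : ℝ)⁻¹ * (Fintype.card W₂ : ℝ)⁻¹ *
        ∑ wa, ∑ wb, ∑ v, K (ca wa) (cb wb) v * ind (dec v ≠ (wa, wb)) ≤
      ∑ a, ∑ b, pa a * (pb b * ∑ v, K a b v * ind (¬ Gd pa pb K θa θb θc a b v))
        + (Fintype.card W₁ : ℝ) * θa⁻¹ + (Fintype.card W₂ : ℝ) * θb⁻¹
        + (Fintype.card W₁ : ℝ) * ((Fintype.card W₂ : ℝ) * θc⁻¹) := by
  set G := Gd pa pb K θa θb θc with hG
  set bd := ∑ a, ∑ b, pa a * (pb b * ∑ v, K a b v * ind (¬ G a b v))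
        + (Fintype.card W₁ : ℝ) * θa⁻¹ + (Fintype.card W₂ : ℝ) * θb⁻¹
        + (Fintype.card W₁ : ℝ) * ((Fintype.card W₂ : ℝ) * θc⁻¹) with hbd
  have key : ∀ (wa : W₁) (wb : W₂), Ecb pa pb (fun (ca : W₁ → A) (cb : W₂ → B) =>
      ∑ v, K (ca wa) (cb wb) v * ind (thDec G ca cb v ≠ (wa, wb))) ≤ bd := by
    intro wa wb
    calc _ ≤ Ecb pa pb (fun (ca : W₁ → A) (cb : W₂ → B) =>
        ∑ v, K (ca wa) (cb wb) v * ind (¬ G (ca wa) (cb wb) v)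
        + ∑ wa' ∈ Finset.univ.erase wa,
            ∑ v, K (ca wa) (cb wb) v * ind (θa * margA pa K (cb wb) v < K (ca wa') (cb wb) v)
        + ∑ wb' ∈ Finset.univ.erase wb,
            ∑ v, K (ca wa) (cb wb) v * ind (θb * margB pb K (ca wa) v < K (ca wa) (cb wb') v)
        + ∑ wa' ∈ Finset.univ.erase wa, ∑ wb' ∈ Finset.univ.erase wb,
            ∑ v, K (ca wa) (cb wb) v * ind (θc * margAB pa pb K v < K (ca wa') (cb wb') v)) := by
          refine Ecb_mono ha hb fun ca cb => ?_
          calc _ ≤ ∑ v, K (ca wa) (cb wb) v * (ind (¬ G (ca wa) (cb wb) v)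
              + ∑ wa' ∈ Finset.univ.erase wa,
                ind (θa * margA pa K (cb wb) v < K (ca wa') (cb wb) v)
              + ∑ wb' ∈ Finset.univ.erase wb,
                ind (θb * margB pb K (ca wa) v < K (ca wa) (cb wb') v)
              + ∑ wa' ∈ Finset.univ.erase wa, ∑ wb' ∈ Finset.univ.erase wb,
                ind (θc * margAB pa pb K v < K (ca wa') (cb wb') v)) := by
                refine Finset.sum_le_sum fun v _ =>
                  mul_le_mul_of_nonneg_left ?_ ((hK _ _).1 v)
                refine (thDec_err G ca cb v wa wb).trans ?_
                gcongr with wa' _ wb' _ wa' _ wb' _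
                · exact ind_mono fun h => h.1
                · exact ind_mono fun h => h.2.1
                · exact ind_mono fun h => h.2.2
            _ = _ := by
                simp only [mul_add, Finset.sum_add_distrib, Finset.mul_sum]
                congr 1
                · congr 1
                  · congr 1
                    exact Finset.sum_comm
                  · exact Finset.sum_comm
                · rw [Finset.sum_comm]
                  exact Finset.sum_congr rfl fun _ _ => Finset.sum_comm
      _ ≤ bd := by
          rw [Ecb_add, Ecb_add, Ecb_add, Ecb_sum (Finset.univ.erase wa),
            Ecb_sum (Finset.univ.erase wb), Ecb_sum (Finset.univ.erase wa)]
          rw [hbd]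
          gcongr
          · exact (Ecb_11 ha hb wa wb (fun a b => ∑ v, K a b v * ind (¬ G a b v))).le
          · refine sum_erase_le _ _ _ (by positivity) fun wa' hw => ?_
            have hne : wa ≠ wa' := ((Finset.mem_erase.1 hw).1).symm
            rw [Ecb_21 ha hb wa wa' hne wb (fun a a' b =>
              ∑ v, K a b v * ind (θa * margA pa K b v < K a' b v))]
            exact conf_a ha hb hK hθa
          · refine sum_erase_le _ _ _ (by positivity) fun wb' hw => ?_
            have hne : wb ≠ wb' := ((Finset.mem_erase.1 hw).1).symm
            rw [Ecb_12 ha hb wa wb wb' hne (fun a b b' =>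
              ∑ v, K a b v * ind (θb * margB pb K a v < K a b' v))]
            exact conf_b ha hb hK hθb
          · refine sum_erase_le _ _ _ (by positivity) fun wa' hw => ?_
            rw [Ecb_sum]
            refine sum_erase_le _ _ _ (by positivity) fun wb' hw' => ?_
            have hne : wa ≠ wa' := ((Finset.mem_erase.1 hw).1).symm
            have hne' : wb ≠ wb' := ((Finset.mem_erase.1 hw').1).symm
            rw [Ecb_22 ha hb wa wa' hne wb wb' hne' (fun a a' b b' =>
              ∑ v, K a b v * ind (θc * margAB pa pb K v < K a' b' v))]
            exact conf_c ha hb hK hθc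
  have tot : Ecb pa pb (fun (ca : W₁ → A) (cb : W₂ → B) =>
      (Fintype.card W₁ : ℝ)⁻¹ * (Fintype.card W₂ : ℝ)⁻¹ *
        ∑ wa, ∑ wb, ∑ v, K (ca wa) (cb wb) v * ind (thDec G ca cb v ≠ (wa, wb))) ≤ bd := by
    rw [Ecb_const_mul, Ecb_sum]
    have h1 : (0 : ℝ) < Fintype.card W₁ := by exact_mod_cast Fintype.card_pos
    have h2 : (0 : ℝ) < Fintype.card W₂ := by exact_mod_cast Fintype.card_pos
    calc _ ≤ (Fintype.card W₁ : ℝ)⁻¹ * (Fintype.card W₂ : ℝ)⁻¹ *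
          ∑ wa : W₁, ∑ wb : W₂, bd := by
          refine mul_le_mul_of_nonneg_left ?_ (by positivity)
          refine Finset.sum_le_sum fun wa _ => ?_
          rw [Ecb_sum]
          exact Finset.sum_le_sum fun wb _ => key wa wb
      _ = bd := by
          simp only [Finset.sum_const, Finset.card_univ, nsmul_eq_mul]
          field_simp
  obtain ⟨ca, cb, h⟩ := Ecb_exists ha hb _ _ tot
  exact ⟨ca, cb, thDec G ca cb, h⟩

end

/-! ### Chernoff bound and the n-letter analysis -/

lemma chernoff {X : Type} [Fintype X] (p f : X → ℝ) (hp : isPMF p) (τ : ℝ)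
    (h : τ < ∑ x, p x * f x) :
    ∃ r : ℝ, 0 ≤ r ∧ r < 1 ∧ ∀ n : ℕ,
      ∑ x : Fin n → X, (∏ t, p (x t)) * ind (∑ t, f (x t) ≤ n * τ) ≤ r ^ n := by
  set g : ℝ → ℝ := fun ρ => ∑ x, p x * Real.exp (ρ * (τ - f x)) with hg
  have hd : HasDerivAt g (∑ x, p x * (τ - f x)) 0 := by
    have : ∀ x ∈ (Finset.univ : Finset X),
        HasDerivAt (fun ρ : ℝ => p x * Real.exp (ρ * (τ - f x))) (p x * (τ - f x)) 0 := by
      intro x _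
      have h1 : HasDerivAt (fun ρ : ℝ => ρ * (τ - f x)) (1 * (τ - f x)) 0 :=
        (hasDerivAt_id (0 : ℝ)).mul_const _
      have h2 := (h1.exp).const_mul (p x)
      simpa using h2
    exact HasDerivAt.fun_sum this
  have hneg : ∑ x, p x * (τ - f x) < 0 := by
    simp only [mul_sub, Finset.sum_sub_distrib, ← Finset.sum_mul, hp.2]
    linarith
  have hg0 : g 0 = 1 := by simp [hg, hp.2]
  have hev := (hasDerivAt_iff_tendsto_slope.1 hd).eventually (gt_mem_nhds hneg)
  have hev2 : ∀ᶠ ρ in nhdsWithin (0 : ℝ) (Set.Ioi 0), slope g 0 ρ < 0 :=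
    hev.filter_mono (nhdsWithin_mono _ (fun x hx => ne_of_gt hx))
  obtain ⟨ρ, hρ, hρ0⟩ := (hev2.and self_mem_nhdsWithin).exists
  have hρ0 : 0 < ρ := hρ0
  refine ⟨g ρ, Finset.sum_nonneg fun x _ => mul_nonneg (hp.1 x) (Real.exp_pos _).le, ?_, ?_⟩
  · rw [slope_def_field, hg0, sub_zero, div_neg_iff] at hρ
    rcases hρ with h1 | h1
    · linarith [h1.2]
    · linarith [h1.1]
  · intro n
    have hpow : g ρ ^ n = ∑ x : Fin n → X, ∏ t, (p (x t) * Real.exp (ρ * (τ - f (x t)))) := by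
      rw [hg]; exact Fintype.sum_pow _ n
    rw [hpow]
    refine Finset.sum_le_sum fun x _ => ?_
    rw [Finset.prod_mul_distrib]
    refine mul_le_mul_of_nonneg_left ?_ (Finset.prod_nonneg fun _ _ => hp.1 _)
    rw [← Real.exp_sum]
    by_cases hx : ∑ t, f (x t) ≤ n * τ
    · rw [ind_true hx]
      apply Real.one_le_exp
      rw [← Finset.mul_sum, Finset.sum_sub_distrib]
      refine mul_nonneg hρ0.le ?_
      simp only [Finset.sum_const, Finset.card_univ, Fintype.card_fin, nsmul_eq_mul]
      linarith
    · rw [ind_false hx]; exact (Real.exp_pos _).le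

lemma log_thresh {n : ℕ} (k m : Fin n → ℝ) (hk : ∀ t, 0 < k t) (hm : ∀ t, 0 < m t) (τ : ℝ)
    (h : ¬ ((2 : ℝ) ^ ((n : ℝ) * τ) * ∏ t, m t < ∏ t, k t)) :
    ∑ t, Real.logb 2 (k t / m t) ≤ n * τ := by
  have hM : 0 < ∏ t, m t := Finset.prod_pos fun t _ => hm t
  have hKK : 0 < ∏ t, k t := Finset.prod_pos fun t _ => hk t
  rw [← Real.logb_prod _ _ (fun t _ => (div_pos (hk t) (hm t)).ne'), Finset.prod_div_distrib,
    Real.logb_le_iff_le_rpow (by norm_num) (div_pos hKK hM), div_le_iff₀ hM]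
  linarith

/-- Reindexing of sequences of tuples. -/
def seqEquiv (n : ℕ) (Q A B S' Y' : Type) : (Fin n → Q × A × B × S' × Y') ≃
    (Fin n → Q) × (Fin n → A) × (Fin n → B) × (Fin n → S') × (Fin n → Y') where
  toFun x := (fun t => (x t).1, fun t => (x t).2.1, fun t => (x t).2.2.1,
    fun t => (x t).2.2.2.1, fun t => (x t).2.2.2.2)
  invFun z := fun t => (z.1 t, z.2.1 t, z.2.2.1 t, z.2.2.2.1 t, z.2.2.2.2 t)
  left_inv _ := rfl
  right_inv _ := rfl

lemma sum_seq {n : ℕ} {Q A B S' Y' : Type} [Fintype Q] [Fintype A] [Fintype B] [Fintype S']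
    [Fintype Y'] (Φ : (Fin n → Q × A × B × S' × Y') → ℝ) :
    ∑ q : Fin n → Q, ∑ a : Fin n → A, ∑ b : Fin n → B, ∑ v : (Fin n → S') × (Fin n → Y'),
      Φ (fun t => (q t, a t, b t, v.1 t, v.2 t)) = ∑ x, Φ x := by
  rw [← (seqEquiv n Q A B S' Y').symm.sum_comp Φ]
  simp only [Fintype.sum_prod_type]
  rfl

/-- n-fold product kernel. -/
def Kn {A B S' Y' : Type} (n : ℕ) (K : A → B → S' × Y' → ℝ) (a : Fin n → A) (b : Fin n → B)
    (v : (Fin n → S') × (Fin n → Y')) : ℝ := ∏ t, K (a t) (b t) (v.1 t, v.2 t)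

/-- n-fold product input law for a given time-sharing sequence. -/
def pn {Q A : Type} (n : ℕ) (p : Q → A → ℝ) (q : Fin n → Q) (a : Fin n → A) : ℝ :=
  ∏ t, p (q t) (a t)

lemma pn_pmf {Q A : Type} [Fintype A] {n : ℕ} {p : Q → A → ℝ} (hp : ∀ q, isPMF (p q))
    (q : Fin n → Q) : isPMF (pn n p q) := by
  refine ⟨fun a => Finset.prod_nonneg fun t _ => (hp _).1 _, ?_⟩
  simp only [pn]
  rw [sum_fun_prod (fun t a => p (q t) a)]
  exact Finset.prod_eq_one fun t _ => (hp _).2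

section
variable {Q A B S' Y' : Type} [Fintype Q] [Fintype A] [Fintype B] [Fintype S']
    [Fintype Y']

lemma sum_pair_fun {n : ℕ} (g : Fin n → A → B → ℝ) :
    ∑ a : Fin n → A, ∑ b : Fin n → B, ∏ t, g t (a t) (b t) = ∏ t, ∑ a, ∑ b, g t a b := by
  have : ∀ a : Fin n → A, ∑ b : Fin n → B, ∏ t, g t (a t) (b t) = ∏ t, ∑ b, g t (a t) b :=
    fun a => sum_fun_prod (fun t b => g t (a t) b)
  simp_rw [this]
  exact sum_fun_prod (fun t a => ∑ b, g t a b)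

lemma Kn_pmf {n : ℕ} {K : A → B → S' × Y' → ℝ} (hK : ∀ a b, isPMF (K a b))
    (a : Fin n → A) (b : Fin n → B) : isPMF (Kn n K a b) := by
  refine ⟨fun v => Finset.prod_nonneg fun t _ => (hK _ _).1 _, ?_⟩
  simp only [Kn, Fintype.sum_prod_type]
  rw [sum_pair_fun (fun t s y => K (a t) (b t) (s, y))]
  refine Finset.prod_eq_one fun t _ => ?_
  rw [← (hK (a t) (b t)).2, Fintype.sum_prod_type]

lemma margA_n {n : ℕ} (pa : Q → A → ℝ) (K : A → B → S' × Y' → ℝ) (q : Fin n → Q)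
    (b : Fin n → B) (v : (Fin n → S') × (Fin n → Y')) :
    margA (pn n pa q) (Kn n K) b v = ∏ t, margA (pa (q t)) K (b t) (v.1 t, v.2 t) := by
  simp only [margA, pn, Kn, ← Finset.prod_mul_distrib]
  exact sum_fun_prod (fun t a => pa (q t) a * K a (b t) (v.1 t, v.2 t))

lemma margB_n {n : ℕ} (pb : Q → B → ℝ) (K : A → B → S' × Y' → ℝ) (q : Fin n → Q)
    (a : Fin n → A) (v : (Fin n → S') × (Fin n → Y')) :
    margB (pn n pb q) (Kn n K) a v = ∏ t, margB (pb (q t)) K (a t) (v.1 t, v.2 t) := by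
  simp only [margB, pn, Kn, ← Finset.prod_mul_distrib]
  exact sum_fun_prod (fun t b => pb (q t) b * K (a t) b (v.1 t, v.2 t))

lemma margAB_n {n : ℕ} (pa : Q → A → ℝ) (pb : Q → B → ℝ) (K : A → B → S' × Y' → ℝ)
    (q : Fin n → Q) (v : (Fin n → S') × (Fin n → Y')) :
    margAB (pn n pa q) (pn n pb q) (Kn n K) v
      = ∏ t, margAB (pa (q t)) (pb (q t)) K (v.1 t, v.2 t) := by
  simp only [margAB, pn, Kn, ← Finset.prod_mul_distrib]
  exact sum_pair_fun (fun t a b => pa (q t) a * (pb (q t) b * K a b (v.1 t, v.2 t)))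

lemma margA_pos {V : Type} {pa : A → ℝ} {K : A → B → V → ℝ} (ha : ∀ a, 0 ≤ pa a)
    (hK : ∀ a b v, 0 ≤ K a b v) {a : A} {b : B} {v : V} (h1 : 0 < pa a) (h2 : 0 < K a b v) :
    0 < margA pa K b v :=
  Finset.sum_pos' (fun a _ => mul_nonneg (ha a) (hK a b v))
    ⟨a, Finset.mem_univ _, mul_pos h1 h2⟩

lemma margB_pos {V : Type} {pb : B → ℝ} {K : A → B → V → ℝ} (hb : ∀ b, 0 ≤ pb b)
    (hK : ∀ a b v, 0 ≤ K a b v) {a : A} {b : B} {v : V} (h1 : 0 < pb b) (h2 : 0 < K a b v) :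
    0 < margB pb K a v :=
  Finset.sum_pos' (fun b _ => mul_nonneg (hb b) (hK a b v))
    ⟨b, Finset.mem_univ _, mul_pos h1 h2⟩

lemma margAB_pos {V : Type} {pa : A → ℝ} {pb : B → ℝ} {K : A → B → V → ℝ}
    (ha : ∀ a, 0 ≤ pa a) (hb : ∀ b, 0 ≤ pb b)
    (hK : ∀ a b v, 0 ≤ K a b v) {a : A} {b : B} {v : V} (h0 : 0 < pa a) (h1 : 0 < pb b)
    (h2 : 0 < K a b v) :
    0 < margAB pa pb K v :=
  Finset.sum_pos' (fun a _ => Finset.sum_nonneg fun b _ =>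
      mul_nonneg (ha a) (mul_nonneg (hb b) (hK a b v)))
    ⟨a, Finset.mem_univ _, Finset.sum_pos' (fun b _ =>
      mul_nonneg (ha a) (mul_nonneg (hb b) (hK a b v)))
      ⟨b, Finset.mem_univ _, mul_pos h0 (mul_pos h1 h2)⟩⟩

/-- Single-letter joint law including the time-sharing variable. -/
def jl (lam : Q → ℝ) (pa : Q → A → ℝ) (pb : Q → B → ℝ) (K : A → B → S' × Y' → ℝ)
    (x : Q × A × B × S' × Y') : ℝ :=
  lam x.1 * (pa x.1 x.2.1 * (pb x.1 x.2.2.1 * K x.2.1 x.2.2.1 x.2.2.2))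

/-- Information densities. -/
def fa (pa : Q → A → ℝ) (K : A → B → S' × Y' → ℝ) (x : Q × A × B × S' × Y') : ℝ :=
  Real.logb 2 (K x.2.1 x.2.2.1 x.2.2.2 / margA (pa x.1) K x.2.2.1 x.2.2.2)

/-- Information densities. -/
def fb (pb : Q → B → ℝ) (K : A → B → S' × Y' → ℝ) (x : Q × A × B × S' × Y') : ℝ :=
  Real.logb 2 (K x.2.1 x.2.2.1 x.2.2.2 / margB (pb x.1) K x.2.1 x.2.2.2)

/-- Information densities. -/
def fc (pa : Q → A → ℝ) (pb : Q → B → ℝ) (K : A → B → S' × Y' → ℝ)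
    (x : Q × A × B × S' × Y') : ℝ :=
  Real.logb 2 (K x.2.1 x.2.2.1 x.2.2.2 / margAB (pa x.1) (pb x.1) K x.2.2.2)

lemma jl_pmf {lam : Q → ℝ} {pa : Q → A → ℝ} {pb : Q → B → ℝ} {K : A → B → S' × Y' → ℝ}
    (hl : isPMF lam) (ha : ∀ q, isPMF (pa q)) (hb : ∀ q, isPMF (pb q))
    (hK : ∀ a b, isPMF (K a b)) : isPMF (jl lam pa pb K) := by
  refine ⟨fun x => mul_nonneg (hl.1 _) (mul_nonneg ((ha _).1 _)
    (mul_nonneg ((hb _).1 _) ((hK _ _).1 _))), ?_⟩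
  rw [Fintype.sum_prod_type]
  simp_rw [Fintype.sum_prod_type (α₁ := A), Fintype.sum_prod_type (α₁ := B)]
  simp only [jl, ← Finset.mul_sum, (hK _ _).2, (hb _).2, (ha _).2, hl.2, mul_one]

lemma bad_event {n : ℕ} {lam : Q → ℝ} {pa : Q → A → ℝ} {pb : Q → B → ℝ}
    {K : A → B → S' × Y' → ℝ}
    (hl : isPMF lam) (ha : ∀ q, isPMF (pa q)) (hb : ∀ q, isPMF (pb q))
    (hK : ∀ a b, isPMF (K a b)) (τa τb τc : ℝ) :
    ∑ q : Fin n → Q, (∏ t, lam (q t)) * ∑ a, ∑ b, pn n pa q a * (pn n pb q b *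
      ∑ v, Kn n K a b v * ind (¬ Gd (pn n pa q) (pn n pb q) (Kn n K)
        ((2 : ℝ) ^ ((n : ℝ) * τa)) ((2 : ℝ) ^ ((n : ℝ) * τb)) ((2 : ℝ) ^ ((n : ℝ) * τc)) a b v))
    ≤ (∑ x : Fin n → Q × A × B × S' × Y', (∏ t, jl lam pa pb K (x t)) *
          ind (∑ t, fa pa K (x t) ≤ n * τa))
      + (∑ x : Fin n → Q × A × B × S' × Y', (∏ t, jl lam pa pb K (x t)) *
          ind (∑ t, fb pb K (x t) ≤ n * τb))
      + (∑ x : Fin n → Q × A × B × S' × Y', (∏ t, jl lam pa pb K (x t)) *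
          ind (∑ t, fc pa pb K (x t) ≤ n * τc)) := by
  rw [← Finset.sum_add_distrib, ← Finset.sum_add_distrib, ← sum_seq]
  simp_rw [Finset.mul_sum]
  refine Finset.sum_le_sum fun q _ => Finset.sum_le_sum fun a _ => Finset.sum_le_sum fun b _ =>
    Finset.sum_le_sum fun v _ => ?_
  have hj : ∏ t, jl lam pa pb K (q t, a t, b t, v.1 t, v.2 t)
      = (∏ t, lam (q t)) * (pn n pa q a * (pn n pb q b * Kn n K a b v)) := by
    simp only [jl, pn, Kn, Finset.prod_mul_distrib]
  have hJ0 : ∀ t, 0 ≤ jl lam pa pb K (q t, a t, b t, v.1 t, v.2 t) :=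
    fun t => (jl_pmf hl ha hb hK).1 _
  rw [← mul_add, ← mul_add]
  set J := ∏ t, jl lam pa pb K (q t, a t, b t, v.1 t, v.2 t) with hJ
  have hJnn : 0 ≤ J := Finset.prod_nonneg fun t _ => hJ0 t
  have hL : ∀ z : ℝ, (∏ t, lam (q t)) * (pn n pa q a * (pn n pb q b * (Kn n K a b v * z)))
      = J * z := by
    intro z; rw [hj]; ring
  rw [hL]
  rcases hJnn.eq_or_lt with h0 | hpos
  · rw [← h0]; simp
  refine mul_le_mul_of_nonneg_left ?_ hJnn
  have hne : ∀ t, jl lam pa pb K (q t, a t, b t, v.1 t, v.2 t) ≠ 0 := by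
    intro t ht
    exact hpos.ne' (Finset.prod_eq_zero (Finset.mem_univ t) ht)
  have pK : ∀ t, 0 < K (a t) (b t) (v.1 t, v.2 t) := fun t =>
    lt_of_le_of_ne ((hK _ _).1 _) fun h => hne t (by simp [jl, ← h])
  have pA : ∀ t, 0 < pa (q t) (a t) := fun t =>
    lt_of_le_of_ne ((ha _).1 _) fun h => hne t (by simp [jl, ← h])
  have pB : ∀ t, 0 < pb (q t) (b t) := fun t =>
    lt_of_le_of_ne ((hb _).1 _) fun h => hne t (by simp [jl, ← h])
  have hKn : ∀ a b v, 0 ≤ K a b v := fun a b => (hK a b).1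
  have i1 := ind_nonneg (∑ t, fa pa K (q t, a t, b t, v.1 t, v.2 t) ≤ n * τa)
  have i2 := ind_nonneg (∑ t, fb pb K (q t, a t, b t, v.1 t, v.2 t) ≤ n * τb)
  have i3 := ind_nonneg (∑ t, fc pa pb K (q t, a t, b t, v.1 t, v.2 t) ≤ n * τc)
  by_cases hG : Gd (pn n pa q) (pn n pb q) (Kn n K)
        ((2 : ℝ) ^ ((n : ℝ) * τa)) ((2 : ℝ) ^ ((n : ℝ) * τb)) ((2 : ℝ) ^ ((n : ℝ) * τc)) a b v
  · rw [ind_false (not_not.2 hG)]; linarith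
  rw [ind_true hG]
  rw [Gd, margA_n, margB_n, margAB_n, not_and_or, not_and_or] at hG
  simp only [Kn] at hG
  rcases hG with hG | hG | hG
  · have := log_thresh _ _ pK (fun t => margA_pos (ha _).1 hKn (pA t) (pK t)) τa hG
    rw [ind_true (p := ∑ t, fa pa K (q t, a t, b t, v.1 t, v.2 t) ≤ n * τa) this]
    linarith
  · have := log_thresh _ _ pK (fun t => margB_pos (hb _).1 hKn (pB t) (pK t)) τb hG
    rw [ind_true (p := ∑ t, fb pb K (q t, a t, b t, v.1 t, v.2 t) ≤ n * τb) this]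
    linarith
  · have := log_thresh _ _ pK
      (fun t => margAB_pos (ha _).1 (hb _).1 hKn (pA t) (pB t) (pK t)) τc hG
    rw [ind_true (p := ∑ t, fc pa pb K (q t, a t, b t, v.1 t, v.2 t) ≤ n * τc) this]
    linarith

lemma exists_le_avg {Z : Type} [Fintype Z] {p : Z → ℝ} (hp : isPMF p) (f : Z → ℝ) (k : ℝ)
    (h : ∑ z, p z * f z ≤ k) : ∃ z, f z ≤ k := by
  by_contra hcon
  push Not at hcon
  have h1 : ∑ z, p z * (f z - k) ≤ 0 := by
    simp only [mul_sub, Finset.sum_sub_distrib, ← Finset.sum_mul, hp.2]; linarith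
  have hnn : ∀ z ∈ Finset.univ, 0 ≤ p z * (f z - k) := fun z _ =>
    mul_nonneg (hp.1 z) (by linarith [hcon z])
  have h2 := (Finset.sum_eq_zero_iff_of_nonneg hnn).1 (le_antisymm h1 (Finset.sum_nonneg hnn))
  have h3 : ∑ z, p z = 0 := Finset.sum_eq_zero fun z hz => by
    rcases mul_eq_zero.1 (h2 z hz) with h | h
    · exact h
    · linarith [hcon z]
  linarith [hp.2]

/-- Achievability for the memoryless multiple access channel with time sharing. -/
theorem mac_achieve {lam : Q → ℝ} {pa : Q → A → ℝ} {pb : Q → B → ℝ}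
    {K : A → B → S' × Y' → ℝ}
    (hl : isPMF lam) (ha : ∀ q, isPMF (pa q)) (hb : ∀ q, isPMF (pb q))
    (hK : ∀ a b, isPMF (K a b)) {Ra Rb : ℝ} (hRa0 : 0 ≤ Ra) (hRb0 : 0 ≤ Rb)
    (hRa : Ra < ∑ x, jl lam pa pb K x * fa pa K x)
    (hRb : Rb < ∑ x, jl lam pa pb K x * fb pb K x)
    (hRc : Ra + Rb < ∑ x, jl lam pa pb K x * fc pa pb K x) {ε : ℝ} (hε : 0 < ε) :
    ∃ N : ℕ, ∀ n : ℕ, N ≤ n → ∃ (Ma Mb : ℕ) (ca : Fin Ma → Fin n → A) (cb : Fin Mb → Fin n → B)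
      (dec : (Fin n → S') × (Fin n → Y') → Fin Ma × Fin Mb),
      Ra ≤ Real.logb 2 Ma / n ∧ Rb ≤ Real.logb 2 Mb / n ∧
      (Fintype.card (Fin Ma) : ℝ)⁻¹ * (Fintype.card (Fin Mb) : ℝ)⁻¹ *
        ∑ wa, ∑ wb, ∑ v, Kn n K (ca wa) (cb wb) v * ind (dec v ≠ (wa, wb)) ≤ ε := by
  obtain ⟨τa, hτa1, hτa2⟩ := exists_between hRa
  obtain ⟨τb, hτb1, hτb2⟩ := exists_between hRb
  obtain ⟨τc, hτc1, hτc2⟩ := exists_between hRc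
  have hj := jl_pmf hl ha hb hK
  obtain ⟨ra, ra0, ra1, hra⟩ := chernoff _ _ hj τa hτa2
  obtain ⟨rb, rb0, rb1, hrb⟩ := chernoff _ _ hj τb hτb2
  obtain ⟨rc, rc0, rc1, hrc⟩ := chernoff _ _ hj τc hτc2
  have hpw : ∀ d : ℝ, d < 0 → Filter.Tendsto (fun n : ℕ => ((2 : ℝ) ^ d) ^ n)
      Filter.atTop (nhds 0) := fun d hd =>
    tendsto_pow_atTop_nhds_zero_of_lt_one (by positivity)
      (Real.rpow_lt_one_of_one_lt_of_neg (by norm_num) hd)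
  have htend : Filter.Tendsto (fun n : ℕ => ra ^ n + rb ^ n + rc ^ n
      + 2 * ((2 : ℝ) ^ (Ra - τa)) ^ n + 2 * ((2 : ℝ) ^ (Rb - τb)) ^ n
      + 4 * ((2 : ℝ) ^ (Ra + Rb - τc)) ^ n) Filter.atTop
      (nhds (0 + 0 + 0 + 2 * 0 + 2 * 0 + 4 * 0)) :=
    ((((((tendsto_pow_atTop_nhds_zero_of_lt_one ra0 ra1).add
      (tendsto_pow_atTop_nhds_zero_of_lt_one rb0 rb1)).add
      (tendsto_pow_atTop_nhds_zero_of_lt_one rc0 rc1)).add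
      ((hpw _ (by linarith)).const_mul 2)).add
      ((hpw _ (by linarith)).const_mul 2)).add
      ((hpw _ (by linarith)).const_mul 4))
  have hev := htend.eventually_lt_const (u := ε) (by simpa using hε)
  obtain ⟨N, hN⟩ := Filter.eventually_atTop.1 hev
  refine ⟨max N 1, fun n hn => ?_⟩
  have hnN : N ≤ n := le_trans (le_max_left _ _) hn
  have hn1 : 1 ≤ n := le_trans (le_max_right _ _) hn
  have hnpos : (0 : ℝ) < n := by exact_mod_cast hn1
  have hceil : ∀ R : ℝ, 0 ≤ R → 0 < ⌈(2 : ℝ) ^ ((n : ℝ) * R)⌉₊ ∧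
      R ≤ Real.logb 2 (⌈(2 : ℝ) ^ ((n : ℝ) * R)⌉₊ : ℕ) / n ∧
      ((⌈(2 : ℝ) ^ ((n : ℝ) * R)⌉₊ : ℕ) : ℝ) ≤ 2 * (2 : ℝ) ^ ((n : ℝ) * R) := by
    intro R hR
    have hp : (0 : ℝ) < (2 : ℝ) ^ ((n : ℝ) * R) := by positivity
    have h1 : (1 : ℝ) ≤ (2 : ℝ) ^ ((n : ℝ) * R) :=
      Real.one_le_rpow (by norm_num) (by positivity)
    have hc := Nat.ceil_pos.2 hp
    refine ⟨hc, ?_, ?_⟩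
    · rw [le_div_iff₀ hnpos, Real.le_logb_iff_rpow_le (by norm_num) (by exact_mod_cast hc),
        mul_comm]
      exact Nat.le_ceil _
    · have := (Nat.ceil_lt_add_one hp.le).le
      linarith
  obtain ⟨hMa0, hMa1, hMa2⟩ := hceil Ra hRa0
  obtain ⟨hMb0, hMb1, hMb2⟩ := hceil Rb hRb0
  set Ma := ⌈(2 : ℝ) ^ ((n : ℝ) * Ra)⌉₊
  set Mb := ⌈(2 : ℝ) ^ ((n : ℝ) * Rb)⌉₊
  haveI : Nonempty (Fin Ma) := ⟨⟨0, hMa0⟩⟩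
  haveI : Nonempty (Fin Mb) := ⟨⟨0, hMb0⟩⟩
  have hbad := (bad_event (n := n) hl ha hb hK τa τb τc).trans
    (add_le_add (add_le_add (hra n) (hrb n)) (hrc n))
  have hlam : isPMF (fun q : Fin n → Q => ∏ t, lam (q t)) :=
    ⟨fun q => Finset.prod_nonneg fun t _ => hl.1 _, sum_cb0 lam hl.2⟩
  obtain ⟨q, hq⟩ := exists_le_avg hlam _ _ hbad
  obtain ⟨ca, cb, dec, hcode⟩ := one_shot (W₁ := Fin Ma) (W₂ := Fin Mb) (pn_pmf ha q)
    (pn_pmf hb q) (Kn_pmf (n := n) hK)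
    (θa := (2 : ℝ) ^ ((n : ℝ) * τa)) (θb := (2 : ℝ) ^ ((n : ℝ) * τb))
    (θc := (2 : ℝ) ^ ((n : ℝ) * τc)) (by positivity) (by positivity) (by positivity)
  refine ⟨Ma, Mb, ca, cb, dec, hMa1, hMb1, hcode.trans ?_⟩
  have hNn := hN n hnN
  simp only [Fintype.card_fin]
  have hexp : ∀ R τ : ℝ, (2 : ℝ) ^ ((n : ℝ) * R) * ((2 : ℝ) ^ ((n : ℝ) * τ))⁻¹
      = ((2 : ℝ) ^ (R - τ)) ^ n := by
    intro R τ
    rw [← Real.rpow_neg (by norm_num), ← Real.rpow_add (by norm_num), ← Real.rpow_natCast,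
      ← Real.rpow_mul (by norm_num)]
    congr 1; ring
  have e1 : (Ma : ℝ) * ((2 : ℝ) ^ ((n : ℝ) * τa))⁻¹ ≤ 2 * ((2 : ℝ) ^ (Ra - τa)) ^ n := by
    rw [← hexp, ← mul_assoc]
    exact mul_le_mul_of_nonneg_right hMa2 (by positivity)
  have e2 : (Mb : ℝ) * ((2 : ℝ) ^ ((n : ℝ) * τb))⁻¹ ≤ 2 * ((2 : ℝ) ^ (Rb - τb)) ^ n := by
    rw [← hexp, ← mul_assoc]
    exact mul_le_mul_of_nonneg_right hMb2 (by positivity)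
  have e3 : (Ma : ℝ) * ((Mb : ℝ) * ((2 : ℝ) ^ ((n : ℝ) * τc))⁻¹)
      ≤ 4 * ((2 : ℝ) ^ (Ra + Rb - τc)) ^ n := by
    rw [← hexp, mul_add, Real.rpow_add (by norm_num), ← mul_assoc, ← mul_assoc]
    refine mul_le_mul_of_nonneg_right ?_ (by positivity)
    calc (Ma : ℝ) * Mb ≤ (2 * (2 : ℝ) ^ ((n : ℝ) * Ra)) * (2 * (2 : ℝ) ^ ((n : ℝ) * Rb)) :=
          mul_le_mul hMa2 hMb2 (by positivity) (by positivity)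
      _ = _ := by ring
  linarith

end

/-! ### Single-letter identities -/

lemma condMutInfo_eq {α β γ : Type} [Fintype α] [Fintype β] [Fintype γ]
    (p : α × β × γ → ℝ) :
    condMutInfo p = ∑ x : α × β × γ, p x * (Real.logb 2 (p x)
      + Real.logb 2 (∑ a, ∑ b, p (a, b, x.2.2))
      - Real.logb 2 (∑ b, p (x.1, b, x.2.2))
      - Real.logb 2 (∑ a, p (a, x.2.1, x.2.2))) := by
  have h1 : ent (fun ac : α × γ => ∑ b, p (ac.1, b, ac.2))
      = - ∑ x : α × β × γ, p x * Real.logb 2 (∑ b, p (x.1, b, x.2.2)) := by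
    simp only [ent, Fintype.sum_prod_type]
    congr 1
    refine Finset.sum_congr rfl fun a _ => ?_
    rw [Finset.sum_comm]
    exact Finset.sum_congr rfl fun c _ => Finset.sum_mul _ _ _
  have h2 : ent (fun bc : β × γ => ∑ a, p (a, bc.1, bc.2))
      = - ∑ x : α × β × γ, p x * Real.logb 2 (∑ a, p (a, x.2.1, x.2.2)) := by
    simp only [ent, Fintype.sum_prod_type]
    congr 1
    rw [Finset.sum_comm (γ := α)]
    refine Finset.sum_congr rfl fun b _ => ?_
    rw [Finset.sum_comm (γ := α)]
    exact Finset.sum_congr rfl fun c _ => Finset.sum_mul _ _ _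
  have h3 : ent (fun c : γ => ∑ a, ∑ b, p (a, b, c))
      = - ∑ x : α × β × γ, p x * Real.logb 2 (∑ a, ∑ b, p (a, b, x.2.2)) := by
    simp only [ent, Fintype.sum_prod_type]
    congr 1
    simp_rw [Finset.sum_mul]
    rw [Finset.sum_comm]
    refine Finset.sum_congr rfl fun a _ => ?_
    rw [Finset.sum_comm]
  rw [condMutInfo, h1, h2, h3, ent]
  simp only [mul_add, mul_sub, Finset.sum_add_distrib, Finset.sum_sub_distrib]
  ring

lemma stratKernel_pmf (M : FSMAC S Sa Sb Xa Xb Y) (ta : Sa → Xa) (tb : Sb → Xb) (s : S) :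
    isPMF (stratKernel M ta tb s) := by
  refine ⟨fun y => Finset.sum_nonneg fun sa _ => Finset.sum_nonneg fun sb _ =>
    mul_nonneg (mul_nonneg ((M.Qa_pmf s).1 _) ((M.Qb_pmf s).1 _)) ((M.chan_pmf _ _ _).1 _), ?_⟩
  simp only [stratKernel]
  rw [Finset.sum_comm]
  calc _ = ∑ sa, ∑ sb, ∑ y, M.Qa s sa * M.Qb s sb * M.chan (ta sa) (tb sb) s y :=
        Finset.sum_congr rfl fun _ _ => Finset.sum_comm
    _ = 1 := by
        simp only [← Finset.mul_sum, (M.chan_pmf _ _ _).2, mul_one, (M.Qb_pmf s).2,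
          (M.Qa_pmf s).2]

/-- Kernel from strategies to the pair (state, output). -/
def Kc (M : FSMAC S Sa Sb Xa Xb Y) (ta : Sa → Xa) (tb : Sb → Xb) (v : S × Y) : ℝ :=
  M.PS v.1 * stratKernel M ta tb v.1 v.2

lemma Kc_pmf (M : FSMAC S Sa Sb Xa Xb Y) (ta : Sa → Xa) (tb : Sb → Xb) :
    isPMF (Kc M ta tb) := by
  refine ⟨fun v => mul_nonneg (M.PS_pmf.1 _) ((stratKernel_pmf M ta tb _).1 _), ?_⟩
  rw [Fintype.sum_prod_type]
  simp only [Kc, ← Finset.mul_sum, (stratKernel_pmf M ta tb _).2, mul_one, M.PS_pmf.2]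

lemma Ia_eq (M : FSMAC S Sa Sb Xa Xb Y) {πa : (Sa → Xa) → ℝ} {πb : (Sb → Xb) → ℝ}
    (ha : isPMF πa) (hb : isPMF πb) :
    Ia M πa πb = ∑ x : (Sa → Xa) × (Sb → Xb) × S × Y,
      πa x.1 * (πb x.2.1 * Kc M x.1 x.2.1 x.2.2) *
        Real.logb 2 (Kc M x.1 x.2.1 x.2.2 / margA πa (Kc M) x.2.1 x.2.2) := by
  rw [Ia, condMutInfo_eq]
  let e : (Sa → Xa) × Y × ((Sb → Xb) × S) ≃ (Sa → Xa) × (Sb → Xb) × S × Y :=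
    { toFun := fun x => (x.1, x.2.2.1, x.2.2.2, x.2.1)
      invFun := fun x => (x.1, x.2.2.2, x.2.1, x.2.2.1)
      left_inv := fun _ => rfl
      right_inv := fun _ => rfl }
  refine Fintype.sum_equiv e _ _ ?_
  rintro ⟨a, y, b, s⟩
  simp only [e, Equiv.coe_fn_mk, teamLaw]
  have m1 : ∑ y', M.PS s * πa a * πb b * stratKernel M a b s y' = M.PS s * πa a * πb b := by
    rw [← Finset.mul_sum, (stratKernel_pmf M a b s).2, mul_one]
  have m2 : ∑ a', M.PS s * πa a' * πb b * stratKernel M a' b s y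
      = πb b * margA πa (Kc M) b (s, y) := by
    rw [margA, Finset.mul_sum]
    exact Finset.sum_congr rfl fun a' _ => by simp only [Kc]; ring
  have m3 : ∑ a', ∑ y', M.PS s * πa a' * πb b * stratKernel M a' b s y' = M.PS s * πb b := by
    simp_rw [← Finset.mul_sum, (stratKernel_pmf M _ b s).2, mul_one, ← Finset.sum_mul,
      ← Finset.mul_sum, ha.2, mul_one]
  rw [m1, m2, m3]
  have hp : M.PS s * πa a * πb b * stratKernel M a b s y
      = πa a * (πb b * Kc M a b (s, y)) := by simp only [Kc]; ring
  rw [hp]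
  by_cases h0 : πa a * (πb b * Kc M a b (s, y)) = 0
  · rw [h0, zero_mul, zero_mul]
  have na : πa a ≠ 0 := fun h => h0 (by simp [h])
  have nb : πb b ≠ 0 := fun h => h0 (by simp [h])
  have nK : Kc M a b (s, y) ≠ 0 := fun h => h0 (by simp [h])
  have nS : M.PS s ≠ 0 := fun h => nK (by simp [Kc, h])
  have nm : margA πa (Kc M) b (s, y) ≠ 0 :=
    (margA_pos ha.1 (fun a b => (Kc_pmf M a b).1) ((ha.1 a).lt_of_ne' na)
      (((Kc_pmf M a b).1 _).lt_of_ne' nK)).ne'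
  congr 1
  rw [Real.logb_mul na (mul_ne_zero nb nK), Real.logb_mul nb nK, Real.logb_mul nS nb,
    Real.logb_mul (mul_ne_zero nS na) nb, Real.logb_mul nS na, Real.logb_mul nb nm,
    Real.logb_div nK nm]
  ring

lemma Ib_eq (M : FSMAC S Sa Sb Xa Xb Y) {πa : (Sa → Xa) → ℝ} {πb : (Sb → Xb) → ℝ}
    (ha : isPMF πa) (hb : isPMF πb) :
    Ib M πa πb = ∑ x : (Sa → Xa) × (Sb → Xb) × S × Y,
      πa x.1 * (πb x.2.1 * Kc M x.1 x.2.1 x.2.2) *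
        Real.logb 2 (Kc M x.1 x.2.1 x.2.2 / margB πb (Kc M) x.1 x.2.2) := by
  rw [Ib, condMutInfo_eq]
  let e : (Sb → Xb) × Y × ((Sa → Xa) × S) ≃ (Sa → Xa) × (Sb → Xb) × S × Y :=
    { toFun := fun x => (x.2.2.1, x.1, x.2.2.2, x.2.1)
      invFun := fun x => (x.2.1, x.2.2.2, x.1, x.2.2.1)
      left_inv := fun _ => rfl
      right_inv := fun _ => rfl }
  refine Fintype.sum_equiv e _ _ ?_
  rintro ⟨b, y, a, s⟩
  simp only [e, Equiv.coe_fn_mk, teamLaw]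
  have m1 : ∑ y', M.PS s * πa a * πb b * stratKernel M a b s y' = M.PS s * πa a * πb b := by
    rw [← Finset.mul_sum, (stratKernel_pmf M a b s).2, mul_one]
  have m2 : ∑ b', M.PS s * πa a * πb b' * stratKernel M a b' s y
      = πa a * margB πb (Kc M) a (s, y) := by
    rw [margB, Finset.mul_sum]
    exact Finset.sum_congr rfl fun a' _ => by simp only [Kc]; ring
  have m3 : ∑ b', ∑ y', M.PS s * πa a * πb b' * stratKernel M a b' s y' = M.PS s * πa a := by
    simp_rw [← Finset.mul_sum, (stratKernel_pmf M a _ s).2, mul_one,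
      ← Finset.mul_sum, hb.2, mul_one]
  rw [m1, m2, m3]
  have hp : M.PS s * πa a * πb b * stratKernel M a b s y
      = πa a * (πb b * Kc M a b (s, y)) := by simp only [Kc]; ring
  rw [hp]
  by_cases h0 : πa a * (πb b * Kc M a b (s, y)) = 0
  · rw [h0, zero_mul, zero_mul]
  have na : πa a ≠ 0 := fun h => h0 (by simp [h])
  have nb : πb b ≠ 0 := fun h => h0 (by simp [h])
  have nK : Kc M a b (s, y) ≠ 0 := fun h => h0 (by simp [h])
  have nS : M.PS s ≠ 0 := fun h => nK (by simp [Kc, h])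
  have nm : margB πb (Kc M) a (s, y) ≠ 0 :=
    (margB_pos hb.1 (fun a b => (Kc_pmf M a b).1) ((hb.1 b).lt_of_ne' nb)
      (((Kc_pmf M a b).1 _).lt_of_ne' nK)).ne'
  congr 1
  rw [Real.logb_mul na (mul_ne_zero nb nK), Real.logb_mul nb nK,
    Real.logb_mul (mul_ne_zero nS na) nb, Real.logb_mul nS na, Real.logb_mul na nm,
    Real.logb_div nK nm]
  ring

lemma Isum_eq (M : FSMAC S Sa Sb Xa Xb Y) {πa : (Sa → Xa) → ℝ} {πb : (Sb → Xb) → ℝ}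
    (ha : isPMF πa) (hb : isPMF πb) :
    Isum M πa πb = ∑ x : (Sa → Xa) × (Sb → Xb) × S × Y,
      πa x.1 * (πb x.2.1 * Kc M x.1 x.2.1 x.2.2) *
        Real.logb 2 (Kc M x.1 x.2.1 x.2.2 / margAB πa πb (Kc M) x.2.2) := by
  rw [Isum, condMutInfo_eq]
  let e : ((Sa → Xa) × (Sb → Xb)) × Y × S ≃ (Sa → Xa) × (Sb → Xb) × S × Y :=
    { toFun := fun x => (x.1.1, x.1.2, x.2.2, x.2.1)
      invFun := fun x => ((x.1, x.2.1), x.2.2.2, x.2.2.1)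
      left_inv := fun _ => rfl
      right_inv := fun _ => rfl }
  refine Fintype.sum_equiv e _ _ ?_
  rintro ⟨⟨a, b⟩, y, s⟩
  simp only [e, Equiv.coe_fn_mk, teamLaw]
  have m1 : ∑ y', M.PS s * πa a * πb b * stratKernel M a b s y' = M.PS s * πa a * πb b := by
    rw [← Finset.mul_sum, (stratKernel_pmf M a b s).2, mul_one]
  have m2 : ∑ x : (Sa → Xa) × (Sb → Xb), M.PS s * πa x.1 * πb x.2 * stratKernel M x.1 x.2 s y
      = margAB πa πb (Kc M) (s, y) := by
    rw [margAB, Fintype.sum_prod_type]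
    exact Finset.sum_congr rfl fun a' _ => Finset.sum_congr rfl fun b' _ => by
      simp only [Kc]; ring
  have m3 : ∑ x : (Sa → Xa) × (Sb → Xb), ∑ y',
      M.PS s * πa x.1 * πb x.2 * stratKernel M x.1 x.2 s y' = M.PS s := by
    simp_rw [← Finset.mul_sum, (stratKernel_pmf M _ _ s).2, mul_one]
    rw [Fintype.sum_prod_type]
    simp_rw [← Finset.mul_sum, hb.2, mul_one, ← Finset.mul_sum, ha.2, mul_one]
  rw [m1, m2, m3]
  have hp : M.PS s * πa a * πb b * stratKernel M a b s y
      = πa a * (πb b * Kc M a b (s, y)) := by simp only [Kc]; ring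
  rw [hp]
  by_cases h0 : πa a * (πb b * Kc M a b (s, y)) = 0
  · rw [h0, zero_mul, zero_mul]
  have na : πa a ≠ 0 := fun h => h0 (by simp [h])
  have nb : πb b ≠ 0 := fun h => h0 (by simp [h])
  have nK : Kc M a b (s, y) ≠ 0 := fun h => h0 (by simp [h])
  have nS : M.PS s ≠ 0 := fun h => nK (by simp [Kc, h])
  have nm : margAB πa πb (Kc M) (s, y) ≠ 0 :=
    (margAB_pos ha.1 hb.1 (fun a b => (Kc_pmf M a b).1) ((ha.1 a).lt_of_ne' na)
      ((hb.1 b).lt_of_ne' nb) (((Kc_pmf M a b).1 _).lt_of_ne' nK)).ne'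
  congr 1
  rw [Real.logb_mul na (mul_ne_zero nb nK), Real.logb_mul nb nK,
    Real.logb_mul (mul_ne_zero nS na) nb, Real.logb_mul nS na,
    Real.logb_div nK nm]
  ring

/-! ### Codes from strategy codebooks -/

/-- Code that applies the strategy of the current time to the current observation. -/
def mkCode (M : FSMAC S Sa Sb Xa Xb Y) {n : ℕ} {Wa Wb : Type}
    (ca : Wa → Fin n → (Sa → Xa)) (cb : Wb → Fin n → (Sb → Xb))
    (dec : (Fin n → S) × (Fin n → Y) → Wa × Wb) : Code M n Wa Wb where
  encA t h w := ca w t (h (Fin.last t.1))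
  encB t h w := cb w t (h (Fin.last t.1))
  dec s y := dec (s, y)

lemma errProb_mkCode (M : FSMAC S Sa Sb Xa Xb Y) {n : ℕ} {Wa Wb : Type} [Fintype Wa]
    [Fintype Wb] (ca : Wa → Fin n → (Sa → Xa)) (cb : Wb → Fin n → (Sb → Xb))
    (dec : (Fin n → S) × (Fin n → Y) → Wa × Wb) :
    errProb M (mkCode M ca cb dec) = (Fintype.card Wa : ℝ)⁻¹ * (Fintype.card Wb : ℝ)⁻¹ *
        ∑ wa, ∑ wb, ∑ v, Kn n (Kc M) (ca wa) (cb wb) v * ind (dec v ≠ (wa, wb)) := by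
  simp only [errProb, codePr]
  rw [Finset.mul_sum]
  refine Finset.sum_congr rfl fun wa _ => ?_
  rw [Finset.mul_sum]
  refine Finset.sum_congr rfl fun wb _ => ?_
  rw [Fintype.sum_prod_type, Finset.mul_sum]
  refine Finset.sum_congr rfl fun s _ => ?_
  calc _ = ∑ sa : Fin n → Sa, ∑ y : Fin n → Y, ∑ sb : Fin n → Sb,
        ((Fintype.card Wa : ℝ)⁻¹ * (Fintype.card Wb : ℝ)⁻¹ * ind (dec (s, y) ≠ (wa, wb))) *
        ∏ t, (M.PS (s t) * M.Qa (s t) (sa t) * M.Qb (s t) (sb t) *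
          M.chan (ca wa t (sa t)) (cb wb t (sb t)) (s t) (y t)) := by
        refine Finset.sum_congr rfl fun sa _ => ?_
        rw [Finset.sum_comm]
        refine Finset.sum_congr rfl fun y _ => ?_
        refine Finset.sum_congr rfl fun sb _ => ?_
        by_cases hd : dec (s, y) ≠ (wa, wb)
        · rw [ind_true hd, if_pos (show (mkCode M ca cb dec).dec s y ≠ (wa, wb) from hd),
            mul_one]
          rfl
        · rw [ind_false hd, if_neg (show ¬ (mkCode M ca cb dec).dec s y ≠ (wa, wb) from hd)]
          ring
    _ = ∑ y : Fin n → Y, ∑ sa : Fin n → Sa, ∑ sb : Fin n → Sb,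
        ((Fintype.card Wa : ℝ)⁻¹ * (Fintype.card Wb : ℝ)⁻¹ * ind (dec (s, y) ≠ (wa, wb))) *
        ∏ t, (M.PS (s t) * M.Qa (s t) (sa t) * M.Qb (s t) (sb t) *
          M.chan (ca wa t (sa t)) (cb wb t (sb t)) (s t) (y t)) := Finset.sum_comm
    _ = _ := by
        rw [Finset.mul_sum]
        refine Finset.sum_congr rfl fun y _ => ?_
        simp_rw [← Finset.mul_sum]
        rw [sum_pair_fun (fun t sa sb => M.PS (s t) * M.Qa (s t) sa * M.Qb (s t) sb *
          M.chan (ca wa t sa) (cb wb t sb) (s t) (y t))]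
        have : Kn n (Kc M) (ca wa) (cb wb) (s, y) = ∏ t, ∑ sa, ∑ sb,
            M.PS (s t) * M.Qa (s t) sa * M.Qb (s t) sb *
              M.chan (ca wa t sa) (cb wb t sb) (s t) (y t) := by
          simp only [Kn, Kc, stratKernel, Finset.mul_sum]
          refine Finset.prod_congr rfl fun t _ => ?_
          refine Finset.sum_congr rfl fun sa _ => ?_
          refine Finset.sum_congr rfl fun sb _ => ?_
          ring
        rw [this]
        ring

lemma sum_lt_weighted {Q : Type} [Fintype Q] {w : Q → ℝ} (hw : isPMF w) {f g : Q → ℝ}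
    (h : ∀ q, f q < g q) : ∑ q, w q * f q < ∑ q, w q * g q := by
  refine Finset.sum_lt_sum (fun q _ => mul_le_mul_of_nonneg_left (h q).le (hw.1 q)) ?_
  by_contra hcon
  push Not at hcon
  have : ∑ q, w q = 0 := Finset.sum_eq_zero fun q hq => by
    by_contra hne
    have hpos : 0 < w q := (hw.1 q).lt_of_ne' hne
    exact absurd (hcon q hq) (not_le.2 (mul_lt_mul_of_pos_left (h q) hpos))
  linarith [hw.2]

lemma sum_jl {Q A B S' Y' : Type} [Fintype Q] [Fintype A] [Fintype B] [Fintype S']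
    [Fintype Y'] (lam : Q → ℝ) (pa : Q → A → ℝ) (pb : Q → B → ℝ) (K : A → B → S' × Y' → ℝ)
    (f : Q × A × B × S' × Y' → ℝ) :
    ∑ x, jl lam pa pb K x * f x = ∑ q, lam q * ∑ x : A × B × S' × Y',
      pa q x.1 * (pb q x.2.1 * K x.1 x.2.1 x.2.2) * f (q, x) := by
  rw [Fintype.sum_prod_type]
  refine Finset.sum_congr rfl fun q _ => ?_
  rw [Finset.mul_sum]
  refine Finset.sum_congr rfl fun x _ => ?_
  simp only [jl]; ring

lemma hull_achievable (M : FSMAC S Sa Sb Xa Xb Y) {Q : Type} [Fintype Q] {w : Q → ℝ}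
    (hw : isPMF w) (z : Q → ℝ × ℝ) (pa : Q → (Sa → Xa) → ℝ) (pb : Q → (Sb → Xb) → ℝ)
    (ha : ∀ q, isPMF (pa q)) (hb : ∀ q, isPMF (pb q))
    (hz : ∀ q, z q ∈ rateRegion M (pa q) (pb q)) :
    Achievable M (∑ q, w q * (z q).1) (∑ q, w q * (z q).2) := by
  have h1 : 0 ≤ ∑ q, w q * (z q).1 :=
    Finset.sum_nonneg fun q _ => mul_nonneg (hw.1 q) (hz q).1
  have h2 : 0 ≤ ∑ q, w q * (z q).2 :=
    Finset.sum_nonneg fun q _ => mul_nonneg (hw.1 q) (hz q).2.1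
  refine ⟨h1, h2, fun ε hε => ?_⟩
  have ca : ∑ q, w q * (z q).1 < ∑ x, jl w pa pb (Kc M) x * fa pa (Kc M) x := by
    rw [sum_jl]
    refine sum_lt_weighted hw fun q => ?_
    have := (hz q).2.2.1
    rwa [Ia_eq M (ha q) (hb q)] at this
  have cb : ∑ q, w q * (z q).2 < ∑ x, jl w pa pb (Kc M) x * fb pb (Kc M) x := by
    rw [sum_jl]
    refine sum_lt_weighted hw fun q => ?_
    have := (hz q).2.2.2.1
    rwa [Ib_eq M (ha q) (hb q)] at this
  have cc : ∑ q, w q * (z q).1 + ∑ q, w q * (z q).2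
      < ∑ x, jl w pa pb (Kc M) x * fc pa pb (Kc M) x := by
    rw [sum_jl, ← Finset.sum_add_distrib]
    simp_rw [← mul_add]
    refine sum_lt_weighted hw fun q => ?_
    have := (hz q).2.2.2.2
    rwa [Isum_eq M (ha q) (hb q)] at this
  obtain ⟨N, hN⟩ := mac_achieve hw ha hb (Kc_pmf M) h1 h2 ca cb cc hε
  refine ⟨N, fun n hn => ?_⟩
  obtain ⟨Ma, Mb, xa, xb, dec, e1, e2, e3⟩ := hN n hn
  refine ⟨Ma, Mb, mkCode M xa xb dec, e1, e2, ?_⟩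
  rw [errProb_mkCode]
  exact e3

/-- **Theorem 1 (Inner bound).** The closure of the convex hull of the union, over all
memoryless stationary team policies `π = (πa, πb)`, of the regions `ℛ(π)` is contained
in the capacity region `C_FS` of the memoryless FS-MAC with i.i.d. state, causal
asymmetric noisy CSIT and complete CSIR. -/
theorem inner_bound {S Sa Sb Xa Xb Y : Type} [Fintype S] [Fintype Sa] [Fintype Sb]
    [Fintype Xa] [Fintype Xb] [Fintype Y] [DecidableEq Sa] [DecidableEq Sb]
    (M : FSMAC S Sa Sb Xa Xb Y) :
    closure (convexHull ℝ
      (⋃ (πa : (Sa → Xa) → ℝ) (πb : (Sb → Xb) → ℝ)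
        (_ : isPMF πa) (_ : isPMF πb), rateRegion M πa πb)) ⊆ capRegion M := by
  refine closure_mono ?_
  intro R hR
  rw [mem_convexHull_iff_exists_fintype] at hR
  obtain ⟨ι, _, w, z, hw0, hw1, hz, hsum⟩ := hR
  simp only [Set.mem_iUnion] at hz
  choose pa pb ha hb hzr using hz
  have := hull_achievable M ⟨hw0, hw1⟩ z pa pb ha hb hzr
  show Achievable M R.1 R.2
  rw [← hsum, Prod.fst_sum, Prod.snd_sum]
  exact this
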